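/- arXiv:1402.5904 — 2 statements merged into one kernel-verified Lean document; each statement's English description precedes it below -/
import Mathlib

section
/- Let n ≥ 17 be an even natural number. Then the minimum length of a TSP tour of the instance G(n, √(n−1)) equals 4n − 4 + 2√(n−1). -/
open Real Filter Finset

noncomputable section

/-- Euclidean distance between two points of the plane. -/
def eucl (p q : ℝ × ℝ) : ℝ := Real.sqrt ((p.1 - q.1) ^ 2 + (p.2 - q.2) ^ 2)

/-- The points of the Euclidean TSP instance `G(n,d)`: the `3n` points
`(i, j·d)` for `i = 1,…,n` and `j = 1,2,3`, indexed by `Fin n × Fin 3`. -/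
def pt (n : ℕ) (d : ℝ) (p : Fin n × Fin 3) : ℝ × ℝ :=
  ((p.1.val : ℝ) + 1, ((p.2.val : ℝ) + 1) * d)

/-- A TSP tour of `G(n,d)`: a cyclic listing of all `3n` points (a Hamiltonian
cycle), given as a sequence `t` that hits every point exactly once in
positions `0,…,3n−1` and returns to its start at position `3n`. -/
def IsTour (n : ℕ) (t : ℕ → Fin n × Fin 3) : Prop :=
  Function.Bijective (fun i : Fin (3 * n) => t i) ∧ t (3 * n) = t 0

/-- The length of a TSP tour: the sum of the Euclidean distances between
consecutive points of the cycle. -/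
def tourLength (n : ℕ) (d : ℝ) (t : ℕ → Fin n × Fin 3) : ℝ :=
  ∑ i ∈ Finset.range (3 * n), eucl (pt n d (t i)) (pt n d (t (i + 1)))

/-- Feasibility for the subtour LP on the points of `G(n,d)`, with symmetric
edge variables `x i j`: degree constraints `∑_{j≠i} x i j = 2`, subtour
elimination constraints (each unordered pair is counted twice in the double
sum, whence the factor 2), and `0 ≤ x i j ≤ 1`. -/
def SubtourLPFeasible (n : ℕ) (x : Fin n × Fin 3 → Fin n × Fin 3 → ℝ) : Prop :=
  (∀ i j, x i j = x j i) ∧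
  (∀ i, x i i = 0) ∧
  (∀ i j, 0 ≤ x i j ∧ x i j ≤ 1) ∧
  (∀ i, ∑ j, x i j = 2) ∧
  (∀ S : Finset (Fin n × Fin 3), S.Nonempty → S ≠ Finset.univ →
      ∑ i ∈ S, ∑ j ∈ S, x i j ≤ 2 * ((S.card : ℝ) - 1))

/-- The objective value of the subtour LP for `G(n,d)`: each unordered pair
appears twice in the double sum, whence the factor `1/2`. -/
def lpValue (n : ℕ) (d : ℝ) (x : Fin n × Fin 3 → Fin n × Fin 3 → ℝ) : ℝ :=
  (1 / 2) * ∑ i, ∑ j, eucl (pt n d i) (pt n d j) * x i j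

/-- The length of a shortest TSP tour of `G(n,d)`. -/
def optTour (n : ℕ) (d : ℝ) : ℝ :=
  sInf {L | ∃ t, IsTour n t ∧ tourLength n d t = L}

/-- The optimum value of the subtour LP for `G(n,d)`. -/
def optLP (n : ℕ) (d : ℝ) : ℝ :=
  sInf {L | ∃ x, SubtourLPFeasible n x ∧ lpValue n d x = L}

/-- `zcost d z` is the length of a z-shaped path covering `z` points in the
middle row of `G(n,d)`. -/
def zcost (d x : ℝ) : ℝ := 2 * (x - 1) + Real.sqrt ((x - 1) ^ 2 + d ^ 2)

section Inside

variable {ι : Type*} [DecidableEq ι]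

/-- The elements of `S` whose successor also lies in `S`. -/
def inside (σ : ι ≃ ι) (S : Finset ι) : Finset ι := {i ∈ S | σ i ∈ S}

/-- The number of elements of `S` whose successor lies outside `S`. -/
def outflow (σ : ι ≃ ι) (S : Finset ι) : ℕ := #{i ∈ S | σ i ∉ S}

lemma card_inside_add_outflow (σ : ι ≃ ι) (S : Finset ι) :
    #(inside σ S) + outflow σ S = #S :=
  Finset.card_filter_add_card_filter_not _

lemma outflow_inter_le (σ : ι ≃ ι) (S T : Finset ι) :
    outflow σ (S ∩ T) ≤ outflow σ S + outflow σ T := by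
  unfold outflow
  refine le_trans (Finset.card_le_card ?_) (Finset.card_union_le _ _)
  intro i
  simp only [Finset.mem_filter, Finset.mem_union, Finset.mem_inter]
  tauto

lemma inside_mono (σ : ι ≃ ι) {S T : Finset ι} (h : S ⊆ T) : inside σ S ⊆ inside σ T := by
  intro i
  simp only [inside, Finset.mem_filter]
  exact fun hi => ⟨h hi.1, h hi.2⟩

end Inside

section CyclicCuts

variable {ι : Type*} [Fintype ι]

/-- No nonempty proper set is closed under the successor map. -/
def IsSingleCycle (σ : ι ≃ ι) : Prop :=
  ∀ A : Finset ι, A.Nonempty → (∀ i ∈ A, σ i ∈ A) → A = Finset.univ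

/-- The elements in columns before `j`. -/
def before (κ : ι → ℕ) (j : ℕ) : Finset ι := {i | κ i < j}

/-- A cyclic order `σ` on points arranged in `n` columns `κ` and three rows `ρ`, with a weight `x`
on edges which is large on edges that change the row. -/
structure IsWeightedCycle (n : ℕ) (d : ℝ) (σ : ι ≃ ι) (κ : ι → ℕ) (ρ : ι → Fin 3)
    (x : ι → ℝ) : Prop where
  cycle : IsSingleCycle σ
  col_lt : ∀ i, κ i < n
  exists_point : ∀ k < n, ∀ r, ∃ i, κ i = k ∧ ρ i = r
  nonneg : ∀ i, 0 ≤ x i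
  row_change_le : ∀ i a, ρ i ≠ ρ (σ i) → κ i ≤ κ (σ i) + a → κ (σ i) ≤ κ i + a →
    d - a ≤ x i ∧ 2 - 2 * ((a : ℝ) + 1) / n ≤ x i

lemma IsWeightedCycle.reflect {n : ℕ} {d : ℝ} {σ : ι ≃ ι} {κ : ι → ℕ} {ρ : ι → Fin 3}
    {x : ι → ℝ} (h : IsWeightedCycle n d σ κ ρ x) :
    IsWeightedCycle n d σ (fun i => n - 1 - κ i) ρ x where
  cycle := h.cycle
  col_lt i := by have := h.col_lt i; omega
  exists_point k hk r := by
    obtain ⟨i, hi, hr⟩ := h.exists_point (n - 1 - k) (by omega) r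
    exact ⟨i, by omega, hr⟩
  nonneg := h.nonneg
  row_change_le i a hr h1 h2 := by
    have := h.col_lt i
    have := h.col_lt (σ i)
    exact h.row_change_le i a hr (by omega) (by omega)

variable [DecidableEq ι]

lemma outflow_compl (σ : ι ≃ ι) (S : Finset ι) : outflow σ Sᶜ = outflow σ S := by
  have h1 := card_inside_add_outflow σ S
  have h2 : #(inside σ S) + outflow σ Sᶜ = #S := by
    have h3 : #(({i | σ i ∈ S} : Finset ι)) = #S := by
      rw [← Finset.card_map σ.toEmbedding]
      congr 1
      ext j
      simp only [Finset.mem_map, Finset.mem_filter, Finset.mem_univ, true_and,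
        Equiv.coe_toEmbedding]
      exact ⟨fun ⟨i, hi, hij⟩ => hij ▸ hi, fun hj => ⟨σ.symm j, by simpa using hj, by simp⟩⟩
    rw [← h3, ← Finset.card_filter_add_card_filter_not (s := {i | σ i ∈ S}) (fun i => i ∈ S)]
    unfold inside outflow
    congr 2
    · ext i; simp [and_comm]
    · ext i; simp [and_comm]
  omega

lemma outflow_pos {σ : ι ≃ ι} (hσ : IsSingleCycle σ) {S : Finset ι} (hS : S.Nonempty)
    (hS' : S ≠ Finset.univ) : 0 < outflow σ S := by
  by_contra h
  refine hS' (hσ S hS fun i hi => ?_)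
  by_contra hi'
  exact h (Finset.card_pos.2 ⟨i, by simp [hi, hi']⟩)

/-- A set meeting all three rows contains at least `3 - outflow` row-changing edges. -/
lemma three_le_card_row_change {σ : ι ≃ ι} (hσ : IsSingleCycle σ) (ρ : ι → Fin 3)
    {S : Finset ι} (hS : ∀ r, ∃ i ∈ S, ρ i = r) :
    3 ≤ #{i ∈ inside σ S | ρ i ≠ ρ (σ i)} + outflow σ S := by
  have hrow : ∀ r, #(inside σ {i ∈ S | ρ i = r}) + 1 ≤ #{i ∈ S | ρ i = r} := by
    intro r
    have h1 := card_inside_add_outflow σ {i ∈ S | ρ i = r}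
    have h2 : 0 < outflow σ {i ∈ S | ρ i = r} := by
      apply outflow_pos hσ
      · obtain ⟨i, hi, hr⟩ := hS r
        exact ⟨i, by simp [hi, hr]⟩
      · intro h
        obtain ⟨i, hi, hr⟩ := hS (r + 1)
        have : i ∈ ({i ∈ S | ρ i = r} : Finset ι) := h ▸ Finset.mem_univ i
        simp only [Finset.mem_filter] at this
        have h3 := hr.symm.trans this.2
        revert h3
        fin_cases r <;> decide
    omega
  have hsum : #S = ∑ r, #{i ∈ S | ρ i = r} :=
    Finset.card_eq_sum_card_fiberwise (fun _ _ => Finset.mem_univ _)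
  have hsame : #{i ∈ inside σ S | ¬ ρ i ≠ ρ (σ i)} = ∑ r, #(inside σ {i ∈ S | ρ i = r}) := by
    rw [Finset.card_eq_sum_card_fiberwise (f := ρ) (t := Finset.univ)
      (fun _ _ => Finset.mem_univ _)]
    refine Finset.sum_congr rfl fun r _ => ?_
    congr 1
    ext i
    simp only [inside, Finset.mem_filter, not_not]
    constructor
    · rintro ⟨⟨⟨h1, h2⟩, h3⟩, h4⟩
      exact ⟨⟨h1, h4⟩, h2, h3 ▸ h4⟩
    · rintro ⟨⟨h1, h4⟩, h2, h3⟩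
      exact ⟨⟨⟨h1, h2⟩, h4.trans h3.symm⟩, h4⟩
  have h1 := card_inside_add_outflow σ S
  have h2 := Finset.card_filter_add_card_filter_not (s := inside σ S) (fun i => ρ i ≠ ρ (σ i))
  have h3 := Finset.sum_le_sum fun r (_ : r ∈ Finset.univ) => hrow r
  rw [Finset.sum_add_distrib] at h3
  simp only [Finset.sum_const, Finset.card_univ, Fintype.card_fin, smul_eq_mul] at h3
  omega

/-- The excess of horizontal crossings over four, plus the weight of all edges, among the first
`q` columns. -/
def leftExcess (σ : ι ≃ ι) (κ : ι → ℕ) (x : ι → ℝ) (q : ℕ) : ℝ :=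
  ∑ j ∈ Finset.Ico 1 q, (2 * (outflow σ (before κ j) : ℝ) - 4) +
    ∑ i ∈ inside σ (before κ q), x i

namespace IsWeightedCycle

variable {n : ℕ} {d : ℝ} {σ : ι ≃ ι} {κ : ι → ℕ} {ρ : ι → Fin 3} {x : ι → ℝ}

lemma outflow_before_pos (h : IsWeightedCycle n d σ κ ρ x) {j : ℕ} (hj : 1 ≤ j) (hjn : j < n) :
    1 ≤ outflow σ (before κ j) := by
  apply outflow_pos h.cycle
  · obtain ⟨i, hi, -⟩ := h.exists_point 0 (by omega) 0
    exact ⟨i, by simp [before]; omega⟩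
  · intro hu
    obtain ⟨i, hi, -⟩ := h.exists_point j hjn 0
    have : i ∈ before κ j := hu ▸ Finset.mem_univ i
    simp [before] at this
    omega

lemma row_change_before (h : IsWeightedCycle n d σ κ ρ x) {q : ℕ} (hq : 1 ≤ q) (hqn : q < n) :
    3 ≤ #{i ∈ inside σ (before κ q) | ρ i ≠ ρ (σ i)} + outflow σ (before κ q) := by
  apply three_le_card_row_change h.cycle
  intro r
  obtain ⟨i, hi, hr⟩ := h.exists_point 0 (by omega) r
  exact ⟨i, by simp [before]; omega, hr⟩

/-- The weight of a row-changing edge `i` within the first `q` columns. -/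
lemma weight_before (h : IsWeightedCycle n d σ κ ρ x) {q : ℕ} {i : ι}
    (hi : i ∈ ({i ∈ inside σ (before κ q) | ρ i ≠ ρ (σ i)} : Finset ι)) :
    d - ((q : ℝ) - 1) ≤ x i ∧ 2 - 2 * (q : ℝ) / n ≤ x i := by
  simp only [inside, before, Finset.mem_filter, Finset.mem_univ, true_and] at hi
  obtain ⟨⟨h1, h2⟩, h3⟩ := hi
  have := h.row_change_le i (q - 1) h3 (by omega) (by omega)
  rw [Nat.cast_sub (by omega)] at this
  simpa using this

lemma sum_Ico_nonneg {p q : ℕ} (hu : ∀ j, p ≤ j → j < q → 2 ≤ outflow σ (before κ j)) :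
    0 ≤ ∑ j ∈ Finset.Ico p q, (2 * (outflow σ (before κ j) : ℝ) - 4) := by
  refine Finset.sum_nonneg fun j hj => ?_
  rw [Finset.mem_Ico] at hj
  have : (2 : ℝ) ≤ outflow σ (before κ j) := by exact_mod_cast hu j hj.1 hj.2
  linarith

lemma sum_Ico_ge {p q : ℕ} (hpq : p ≤ q)
    (hu : ∀ j, p ≤ j → j < q → 3 ≤ outflow σ (before κ j)) :
    2 * ((q : ℝ) - p) ≤ ∑ j ∈ Finset.Ico p q, (2 * (outflow σ (before κ j) : ℝ) - 4) := by
  have := Finset.card_nsmul_le_sum (Finset.Ico p q)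
    (fun j => 2 * (outflow σ (before κ j) : ℝ) - 4) 2 fun j hj => by
      rw [Finset.mem_Ico] at hj
      have : (3 : ℝ) ≤ outflow σ (before κ j) := by exact_mod_cast hu j hj.1 hj.2
      linarith
  rw [Nat.card_Ico, nsmul_eq_mul, Nat.cast_sub hpq] at this
  linarith

/-- A row-changing edge near the left end, together with the crossings there, pays for `d`. -/
lemma exists_first_row_change (h : IsWeightedCycle n d σ κ ρ x) {q : ℕ} (hq : 1 ≤ q)
    (hqn : q < n) (hu : outflow σ (before κ q) ≤ 2)
    (hlt : ∀ j, 1 ≤ j → j < q → 2 ≤ outflow σ (before κ j)) :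
    ∃ i ∈ ({i ∈ inside σ (before κ q) | ρ i ≠ ρ (σ i)} : Finset ι),
      d ≤ ∑ j ∈ Finset.Ico 1 q, (2 * (outflow σ (before κ j) : ℝ) - 4) + x i := by
  classical
  have hex : ∃ r, 1 ≤ r ∧ outflow σ (before κ r) ≤ 2 := ⟨q, hq, hu⟩
  obtain ⟨hr1, hr2⟩ := Nat.find_spec hex
  have hrq : Nat.find hex ≤ q := Nat.find_min' hex ⟨hq, hu⟩
  have hmin : ∀ j, 1 ≤ j → j < Nat.find hex → 3 ≤ outflow σ (before κ j) := by
    intro j hj hjr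
    have := Nat.find_min hex hjr
    omega
  generalize Nat.find hex = r at *
  have hc := h.row_change_before hr1 (by omega)
  obtain ⟨i, hi⟩ := Finset.card_pos.1
    (show 0 < #{i ∈ inside σ (before κ r) | ρ i ≠ ρ (σ i)} by omega)
  refine ⟨i, ?_, ?_⟩
  · rw [Finset.mem_filter] at hi ⊢
    refine ⟨inside_mono σ (fun k => ?_) hi.1, hi.2⟩
    simp only [before, Finset.mem_filter, Finset.mem_univ, true_and]
    omega
  · have h1 := (h.weight_before hi).1
    rw [← Finset.sum_Ico_consecutive _ hr1 hrq]
    have h2 := sum_Ico_ge hr1 hmin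
    have h3 := sum_Ico_nonneg (σ := σ) (κ := κ) (p := r) (q := q)
      fun j hj hj' => hlt j (by omega) hj'
    have h4 : (1 : ℝ) ≤ r := by exact_mod_cast hr1
    push_cast at h2
    linarith

lemma le_leftExcess (h : IsWeightedCycle n d σ κ ρ x) {q : ℕ} (hq : 1 ≤ q) (hqn : q < n)
    (hu : outflow σ (before κ q) ≤ 2)
    (hlt : ∀ j, 1 ≤ j → j < q → 2 ≤ outflow σ (before κ j)) :
    d ≤ leftExcess σ κ x q := by
  obtain ⟨i, hi, hd⟩ := h.exists_first_row_change hq hqn hu hlt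
  have := Finset.single_le_sum (f := x) (fun k _ => h.nonneg k) (Finset.mem_filter.1 hi).1
  unfold leftExcess
  linarith

lemma exists_row_change_between (h : IsWeightedCycle n d σ κ ρ x) {p q : ℕ} (hpq : p < q)
    (hqn : q < n) (hup : outflow σ (before κ p) = 1) (huq : outflow σ (before κ q) = 1) :
    ∃ i ∈ inside σ ((before κ p)ᶜ ∩ before κ q), 2 - 2 * ((q : ℝ) - p) / n ≤ x i := by
  have hle := outflow_inter_le σ (before κ p)ᶜ (before κ q)
  rw [outflow_compl] at hle
  have hc := three_le_card_row_change h.cycle ρ (S := (before κ p)ᶜ ∩ before κ q) fun r => by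
    obtain ⟨i, hi, hr⟩ := h.exists_point p (by omega) r
    exact ⟨i, by simp [before]; omega, hr⟩
  obtain ⟨i, hi⟩ := Finset.card_pos.1
    (show 0 < #{i ∈ inside σ ((before κ p)ᶜ ∩ before κ q) | ρ i ≠ ρ (σ i)} by omega)
  rw [Finset.mem_filter] at hi
  refine ⟨i, hi.1, ?_⟩
  obtain ⟨hi, h3⟩ := hi
  simp only [inside, before, Finset.mem_filter, Finset.mem_univ, true_and, Finset.mem_inter,
    Finset.mem_compl, not_lt] at hi
  have := (h.row_change_le i (q - p - 1) h3 (by omega) (by omega)).2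
  rw [Nat.sub_sub, Nat.cast_sub (by omega)] at this
  push_cast at this
  convert this using 3
  ring

/-- If only two edges cross out of the first `q` columns, then their excess is at least
`d + 2 - 2 q / n`. -/
lemma le_leftExcess_of_outflow_eq_one (h : IsWeightedCycle n d σ κ ρ x) {q : ℕ} (hq : 1 ≤ q)
    (hqn : q < n) (hu : outflow σ (before κ q) = 1) :
    d + 2 - 2 * (q : ℝ) / n ≤ leftExcess σ κ x q := by
  induction q using Nat.strong_induction_on with
  | _ q ih =>
  by_cases hex : ∃ p, 1 ≤ p ∧ p < q ∧ outflow σ (before κ p) = 1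
  · obtain ⟨p, ⟨hp1, hpq, hup⟩, hmax⟩ : ∃ p, (1 ≤ p ∧ p < q ∧ outflow σ (before κ p) = 1) ∧
        ∀ j, p < j → j < q → 2 ≤ outflow σ (before κ j) := by
      classical
      obtain ⟨p₀, hp₀⟩ := hex
      have hs := Nat.findGreatest_spec (P := fun p => 1 ≤ p ∧ p < q ∧ outflow σ (before κ p) = 1)
        (n := q) hp₀.2.1.le hp₀
      refine ⟨_, hs, fun j hj hjq => ?_⟩
      have h1 := Nat.findGreatest_is_greatest hj hjq.le
      have h2 := h.outflow_before_pos (j := j) (by omega) (by omega)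
      by_contra h3
      exact h1 ⟨by omega, hjq, by omega⟩
    have ihp := ih p hpq hp1 (by omega) hup
    obtain ⟨i, hi, hxi⟩ := h.exists_row_change_between hpq hqn hup hu
    unfold leftExcess at ihp ⊢
    rw [← Finset.sum_Ico_consecutive _ hp1 hpq.le, Finset.sum_eq_sum_Ico_succ_bot hpq, hup]
    have h1 := sum_Ico_nonneg (σ := σ) (κ := κ) (p := p + 1) (q := q)
      fun j hj hj' => hmax j (by omega) hj'
    have hi' : i ∉ inside σ (before κ p) := by
      simp only [inside, Finset.mem_filter, Finset.mem_inter, Finset.mem_compl] at hi ⊢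
      tauto
    have h2 : ∑ k ∈ inside σ (before κ p), x k + x i ≤ ∑ k ∈ inside σ (before κ q), x k := by
      rw [add_comm, ← Finset.sum_insert hi']
      refine Finset.sum_le_sum_of_subset_of_nonneg ?_ fun k _ _ => h.nonneg k
      rw [Finset.insert_subset_iff]
      refine ⟨inside_mono σ Finset.inter_subset_right hi, inside_mono σ fun k => ?_⟩
      simp only [before, Finset.mem_filter, Finset.mem_univ, true_and]
      omega
    have h3 : 2 * ((q : ℝ) - p) / n = 2 * (q : ℝ) / n - 2 * (p : ℝ) / n := by ring
    push_cast
    linarith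
  · obtain ⟨i, hi, hd⟩ := h.exists_first_row_change hq hqn hu.le.step fun j hj hjq => by
      have := h.outflow_before_pos hj (by omega)
      by_contra h3
      exact hex ⟨j, hj, hjq, by omega⟩
    have hc := h.row_change_before hq hqn
    obtain ⟨k, hk, hki⟩ := Finset.exists_mem_ne
      (show 1 < #{i ∈ inside σ (before κ q) | ρ i ≠ ρ (σ i)} by omega) i
    have hxk := (h.weight_before hk).2
    have h2 : x k + x i ≤ ∑ k ∈ inside σ (before κ q), x k := by
      rw [← Finset.sum_pair hki]
      refine Finset.sum_le_sum_of_subset_of_nonneg ?_ fun k _ _ => h.nonneg k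
      simp [Finset.insert_subset_iff, (Finset.mem_filter.1 hi).1, (Finset.mem_filter.1 hk).1]
    unfold leftExcess
    linarith

lemma before_reflect (h : IsWeightedCycle n d σ κ ρ x) {j : ℕ} (hjn : j ≤ n) :
    before (fun i => n - 1 - κ i) (n - j) = (before κ j)ᶜ := by
  ext i
  have := h.col_lt i
  simp only [before, Finset.mem_filter, Finset.mem_univ, true_and, Finset.mem_compl]
  omega

lemma leftExcess_reflect (h : IsWeightedCycle n d σ κ ρ x) {q : ℕ} (hqn : q < n) :
    leftExcess σ (fun i => n - 1 - κ i) x (n - q) =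
      ∑ j ∈ Finset.Ico (q + 1) n, (2 * (outflow σ (before κ j) : ℝ) - 4) +
        ∑ i ∈ inside σ (before κ q)ᶜ, x i := by
  unfold leftExcess
  rw [h.before_reflect hqn.le]
  congr 1
  refine Finset.sum_bij' (fun j _ => n - j) (fun j _ => n - j) ?_ ?_ ?_ ?_ ?_ <;>
    intro j hj <;> rw [Finset.mem_Ico] at hj
  · rw [Finset.mem_Ico]; omega
  · rw [Finset.mem_Ico]; omega
  · omega
  · omega
  · have := h.before_reflect (j := n - j) (by omega)
    rw [show n - (n - j) = j by omega] at this
    rw [this, outflow_compl]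

lemma add_leftExcess_le (h : IsWeightedCycle n d σ κ ρ x) {q : ℕ} (hq : 1 ≤ q) (hqn : q < n) :
    leftExcess σ κ x q + (2 * (outflow σ (before κ q) : ℝ) - 4) +
        leftExcess σ (fun i => n - 1 - κ i) x (n - q) ≤
      ∑ j ∈ Finset.Ico 1 n, (2 * (outflow σ (before κ j) : ℝ) - 4) + ∑ i, x i := by
  rw [h.leftExcess_reflect hqn]
  unfold leftExcess
  rw [← Finset.sum_Ico_consecutive _ hq hqn.le, Finset.sum_eq_sum_Ico_succ_bot hqn]
  have hdis : Disjoint (inside σ (before κ q)) (inside σ (before κ q)ᶜ) := by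
    rw [Finset.disjoint_left]
    intro i
    simp only [inside, Finset.mem_filter, Finset.mem_compl]
    tauto
  have := Finset.sum_le_sum_of_subset_of_nonneg (f := x)
    (Finset.subset_univ (inside σ (before κ q) ∪ inside σ (before κ q)ᶜ))
    fun k _ _ => h.nonneg k
  rw [Finset.sum_union hdis] at this
  linarith

lemma outflow_reflect (h : IsWeightedCycle n d σ κ ρ x) {j : ℕ} (hjn : j ≤ n) :
    outflow σ (before (fun i => n - 1 - κ i) (n - j)) = outflow σ (before κ j) := by
  rw [h.before_reflect hjn, outflow_compl]

theorem two_mul_le_excess (h : IsWeightedCycle n d σ κ ρ x) (hn : 1 ≤ n) (hd : d ≤ (n : ℝ) - 1) :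
    2 * d ≤ ∑ j ∈ Finset.Ico 1 n, (2 * (outflow σ (before κ j) : ℝ) - 4) + ∑ i, x i := by
  by_cases h1 : ∃ q, 1 ≤ q ∧ q < n ∧ outflow σ (before κ q) = 1
  · obtain ⟨q, hq, hqn, hu⟩ := h1
    have hl := h.le_leftExcess_of_outflow_eq_one hq hqn hu
    have hr := h.reflect.le_leftExcess_of_outflow_eq_one (q := n - q) (by omega) (by omega)
      (by rw [h.outflow_reflect hqn.le, hu])
    have ht := h.add_leftExcess_le hq hqn
    rw [hu] at ht
    rw [Nat.cast_sub hqn.le] at hr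
    have hn0 : (n : ℝ) ≠ 0 := by positivity
    have h3 : 2 * ((n : ℝ) - q) / n = 2 - 2 * (q : ℝ) / n := by field_simp
    push_cast at ht
    linarith
  have hge : ∀ j, 1 ≤ j → j < n → 2 ≤ outflow σ (before κ j) := fun j hj hjn => by
    have := h.outflow_before_pos hj hjn
    by_contra h3
    exact h1 ⟨j, hj, hjn, by omega⟩
  by_cases h2 : ∃ q, 1 ≤ q ∧ q < n ∧ outflow σ (before κ q) = 2
  · obtain ⟨q, hq, hqn, hu⟩ := h2
    have hl := h.le_leftExcess hq hqn hu.le fun j hj hjq => hge j hj (by omega)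
    have hr := h.reflect.le_leftExcess (q := n - q) (by omega) (by omega)
      (by rw [h.outflow_reflect hqn.le, hu]) fun j hj hjq => by
        have h4 := h.outflow_reflect (j := n - j) (by omega)
        rw [show n - (n - j) = j by omega] at h4
        rw [h4]
        exact hge _ (by omega) (by omega)
    have ht := h.add_leftExcess_le hq hqn
    rw [hu] at ht
    push_cast at ht
    linarith
  · have := sum_Ico_ge (σ := σ) (κ := κ) hn fun j hj hjn => by
      have := hge j hj hjn
      by_contra h3
      exact h2 ⟨j, hj, hjn, by omega⟩
    have hx := Finset.sum_nonneg fun i (_ : i ∈ Finset.univ) => h.nonneg i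
    push_cast at this
    linarith

end IsWeightedCycle

/-- The total horizontal displacement counts the crossings of all gaps between columns. -/
lemma sum_abs_sub_eq_sum_outflow (σ : ι ≃ ι) {κ : ι → ℕ} {n : ℕ} (hκ : ∀ i, κ i < n) :
    ∑ i, |(κ i : ℝ) - κ (σ i)| = ∑ j ∈ Finset.Ico 1 n, 2 * (outflow σ (before κ j) : ℝ) := by
  have hout : ∀ j, 2 * (outflow σ (before κ j) : ℝ) = ∑ i,
      ((if κ i < j ∧ j ≤ κ (σ i) then (1 : ℝ) else 0) +
        if κ (σ i) < j ∧ j ≤ κ i then (1 : ℝ) else 0) := by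
    intro j
    rw [Finset.sum_add_distrib, Finset.sum_boole, Finset.sum_boole, two_mul]
    congr 2
    · unfold outflow before
      congr 1
      ext i
      simp
    · rw [← outflow_compl]
      unfold outflow before
      congr 1
      ext i
      simp [and_comm]
  have habs : ∀ a b : ℕ, a < n → b < n → |(a : ℝ) - b| = ∑ j ∈ Finset.Ico 1 n,
      ((if a < j ∧ j ≤ b then (1 : ℝ) else 0) + if b < j ∧ j ≤ a then (1 : ℝ) else 0) := by
    intro a b ha hb
    have hf : ∀ a b : ℕ, b < n →
        ({j ∈ Finset.Ico 1 n | a < j ∧ j ≤ b} : Finset ℕ) = Finset.Ioc a b := by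
      intro a b hb
      ext j
      simp only [Finset.mem_filter, Finset.mem_Ico, Finset.mem_Ioc]
      omega
    rw [Finset.sum_add_distrib, Finset.sum_boole, Finset.sum_boole, hf a b hb, hf b a ha,
      Nat.card_Ioc, Nat.card_Ioc]
    rcases le_total a b with hab | hab
    · rw [Nat.sub_eq_zero_of_le hab, Nat.cast_sub hab, abs_sub_comm, abs_of_nonneg] <;> simp [hab]
    · rw [Nat.sub_eq_zero_of_le hab, Nat.cast_sub hab, abs_of_nonneg] <;> simp [hab]
  simp_rw [hout]
  rw [Finset.sum_comm]
  exact Finset.sum_congr rfl fun i _ => habs _ _ (hκ i) (hκ (σ i))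

end CyclicCuts

lemma isSingleCycle_addRight_one (N : ℕ) [NeZero N] :
    IsSingleCycle (Equiv.addRight (1 : Fin N)) := by
  intro A ⟨i, hi⟩ hA
  have key : ∀ k : ℕ, i + Fin.ofNat N k ∈ A := by
    intro k
    induction k with
    | zero => simpa using hi
    | succ k ih =>
      have h1 := hA _ ih
      have h2 : Fin.ofNat N (k + 1) = Fin.ofNat N k + 1 := by
        ext
        simp [Fin.val_add, Fin.ofNat]
      rw [h2, ← add_assoc]
      exact h1
  refine Finset.eq_univ_of_forall fun j => ?_
  have h1 := key (j - i).val
  rw [Fin.ofNat_val_eq_self] at h1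
  simpa using h1

lemma abs_sub_le_eucl (p q : ℝ × ℝ) : |p.1 - q.1| ≤ eucl p q :=
  Real.abs_le_sqrt (by nlinarith [sq_nonneg (p.2 - q.2)])

lemma le_eucl_of_row_ne {n : ℕ} {d : ℝ} {p q : Fin n × Fin 3} (h : p.2 ≠ q.2) :
    Real.sqrt (((pt n d p).1 - (pt n d q).1) ^ 2 + d ^ 2) ≤ eucl (pt n d p) (pt n d q) := by
  unfold eucl
  apply Real.sqrt_le_sqrt
  have h1 : (1 : ℝ) ≤ ((p.2.val : ℝ) - q.2.val) ^ 2 := by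
    have h2 : (p.2.val : ℤ) - q.2.val ≠ 0 := by
      intro h0
      exact h (Fin.ext (by omega))
    have h3 : (1 : ℤ) ≤ ((p.2.val : ℤ) - q.2.val) ^ 2 := by
      have := sq_pos_of_ne_zero h2
      omega
    exact_mod_cast h3
  have h4 : ((pt n d p).2 - (pt n d q).2) ^ 2 = ((p.2.val : ℝ) - q.2.val) ^ 2 * d ^ 2 := by
    simp only [pt]
    ring
  rw [h4]
  nlinarith [sq_nonneg d]

/-- The tangent line bound for `√(a² + d²) - a` at `a = n / 2 - 1`, where `d² = n - 1`. -/
lemma two_sub_le_sqrt_sub {n a : ℝ} (hn : 1 ≤ n) :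
    2 - 2 * (a + 1) / n ≤ Real.sqrt (a ^ 2 + (n - 1)) - a := by
  have hn0 : 0 < n := by linarith
  rw [le_sub_iff_add_le]
  apply Real.le_sqrt_of_sq_le
  have h : a ^ 2 + (n - 1) - (2 - 2 * (a + 1) / n + a) ^ 2 =
      (n - 1) * ((2 * a - (n - 2)) / n) ^ 2 := by
    field_simp
    ring
  have := mul_nonneg (sub_nonneg.2 hn) (sq_nonneg ((2 * a - (n - 2)) / n))
  linarith

lemma isWeightedCycle_of_isTour {n : ℕ} [NeZero (3 * n)] (hn : 1 ≤ n)
    {t : ℕ → Fin n × Fin 3} (ht : IsTour n t) {d : ℝ} (hd : d = Real.sqrt ((n : ℝ) - 1)) :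
    IsWeightedCycle n d (Equiv.addRight (1 : Fin (3 * n)))
      (fun i => (t i).1) (fun i => (t i).2)
      (fun i => eucl (pt n d (t i)) (pt n d (t (i + 1 : Fin (3 * n)))) -
        |((t i).1 : ℝ) - (t (i + 1 : Fin (3 * n))).1|) where
  cycle := isSingleCycle_addRight_one _
  col_lt i := (t i).1.isLt
  exists_point k hk r := by
    obtain ⟨i, hi⟩ := ht.1.2 (⟨k, hk⟩, r)
    have hi : t i = (⟨k, hk⟩, r) := hi
    exact ⟨i, by simp [hi], by simp [hi]⟩
  nonneg i := by
    have := abs_sub_le_eucl (pt n d (t i)) (pt n d (t (i + 1 : Fin (3 * n))))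
    simp only [pt, add_sub_add_right_eq_sub] at this
    simpa [pt] using this
  row_change_le i a hr h1 h2 := by
    simp only [Equiv.coe_addRight] at hr h1 h2
    have hn1 : (1 : ℝ) ≤ n := by exact_mod_cast hn
    have hle := le_eucl_of_row_ne (d := d) hr
    have hx : (pt n d (t i)).1 - (pt n d (t (i + 1 : Fin (3 * n)))).1 =
        ((t i).1 : ℝ) - (t (i + 1 : Fin (3 * n))).1 := by simp [pt]
    rw [hx, ← sq_abs (_ - _)] at hle
    have hb : |((t i).1 : ℝ) - (t (i + 1 : Fin (3 * n))).1| ≤ a := by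
      rw [abs_sub_le_iff]
      have h1' : ((t i).1 : ℝ) ≤ (t (i + 1 : Fin (3 * n))).1 + a := by exact_mod_cast h1
      have h2' : ((t (i + 1 : Fin (3 * n))).1 : ℝ) ≤ (t i).1 + a := by exact_mod_cast h2
      constructor <;> linarith
    generalize |((t i).1 : ℝ) - (t (i + 1 : Fin (3 * n))).1| = b at *
    constructor
    · have := (Real.le_sqrt_of_sq_le (x := d) (y := b ^ 2 + d ^ 2)
        (by linarith [sq_nonneg b])).trans hle
      linarith
    · rw [hd, Real.sq_sqrt (by linarith), ← hd] at hle
      have h3 := two_sub_le_sqrt_sub (a := b) hn1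
      have h4 : 2 * (b + 1) / (n : ℝ) ≤ 2 * (a + 1) / n := by gcongr
      linarith

theorem le_tourLength {n : ℕ} (hn : 2 ≤ n) {t : ℕ → Fin n × Fin 3} (ht : IsTour n t) :
    4 * (n : ℝ) - 4 + 2 * Real.sqrt ((n : ℝ) - 1) ≤
      tourLength n (Real.sqrt ((n : ℝ) - 1)) t := by
  have : NeZero (3 * n) := ⟨by omega⟩
  have hn2 : (2 : ℝ) ≤ n := by exact_mod_cast hn
  have hcyc := isWeightedCycle_of_isTour (by omega) ht rfl
  have hex := hcyc.two_mul_le_excess (by omega) (by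
    rw [Real.sqrt_le_left (by linarith)]
    nlinarith)
  have hhor := sum_abs_sub_eq_sum_outflow (Equiv.addRight (1 : Fin (3 * n))) hcyc.col_lt
  simp only [Equiv.coe_addRight] at hhor
  rw [Finset.sum_sub_distrib, Finset.sum_sub_distrib, ← hhor] at hex
  have hlen : tourLength n (Real.sqrt ((n : ℝ) - 1)) t =
      ∑ i : Fin (3 * n), eucl (pt n (Real.sqrt ((n : ℝ) - 1)) (t i))
        (pt n (Real.sqrt ((n : ℝ) - 1)) (t (i + 1 : Fin (3 * n)))) := by
    unfold tourLength
    rw [Finset.sum_range]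
    refine Finset.sum_congr rfl fun i _ => ?_
    have hi : t (i + 1 : Fin (3 * n)) = t (i + 1) := by
      have h1 : (1 : Fin (3 * n)).val = 1 := by
        rw [Fin.val_one']
        exact Nat.mod_eq_of_lt (by omega)
      rw [Fin.val_add, h1]
      rcases Nat.lt_or_ge (i.val + 1) (3 * n) with h | h
      · rw [Nat.mod_eq_of_lt h]
      · have : i.val + 1 = 3 * n := by omega
        rw [this, Nat.mod_self, ht.2]
    rw [hi]
  rw [hlen]
  simp only [Finset.sum_const, Nat.card_Ico, nsmul_eq_mul] at hex
  rw [Nat.cast_sub (by omega)] at hex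
  push_cast at hex
  linarith

/-- The column of the `i`-th point of the tour `optimalTour`. -/
def optimalCol (m i : ℕ) : ℕ :=
  if i < m then i else if i < 3 * m then i - m else if i < 4 * m then i - 2 * m
    else 6 * m - 1 - i

/-- The row of the `i`-th point of the tour `optimalTour`. -/
def optimalRow (m i : ℕ) : ℕ :=
  if i < m then 1 else if i < 3 * m then 2 else if i < 4 * m then 1
    else if i < 6 * m then 0 else 1

/-- The tour through the left half of the middle row, the top row, the right half of the middle
row, and back through the bottom row. -/
def optimalTour (m : ℕ) (hm : 0 < m) (i : ℕ) : Fin (m + m) × Fin 3 :=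
  (⟨optimalCol m i, by unfold optimalCol; split_ifs <;> omega⟩,
    ⟨optimalRow m i, by unfold optimalRow; split_ifs <;> omega⟩)

lemma isTour_optimalTour (m : ℕ) (hm : 0 < m) : IsTour (m + m) (optimalTour m hm) := by
  constructor
  · rw [Fintype.bijective_iff_injective_and_card]
    constructor
    · intro i j hij
      simp only [optimalTour, Prod.mk.injEq, Fin.mk.injEq] at hij
      obtain ⟨h1, h2⟩ := hij
      have := i.isLt
      have := j.isLt
      unfold optimalCol at h1
      unfold optimalRow at h2
      apply Fin.ext
      split_ifs at h1 h2 <;> omega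
    · simp [mul_comm]
  · simp only [optimalTour, Prod.mk.injEq, Fin.mk.injEq]
    unfold optimalCol optimalRow
    constructor <;> split_ifs <;> omega

lemma eucl_pt_of_row_eq {n : ℕ} {d : ℝ} {p q : Fin n × Fin 3} (h : p.2.val = q.2.val) :
    eucl (pt n d p) (pt n d q) = |(p.1 : ℝ) - q.1| := by
  simp [eucl, pt, h, Real.sqrt_sq_eq_abs]

lemma eucl_pt_of_row_adj {n : ℕ} {d : ℝ} {p q : Fin n × Fin 3}
    (h : p.2.val + 1 = q.2.val ∨ q.2.val + 1 = p.2.val) :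
    eucl (pt n d p) (pt n d q) = Real.sqrt (((p.1 : ℝ) - q.1) ^ 2 + d ^ 2) := by
  unfold eucl pt
  congr 1
  rcases h with h | h
  · rw [← h]; push_cast; ring
  · rw [← h]; push_cast; ring

lemma tourLength_optimalTour {m : ℕ} (hm : 0 < m) {d : ℝ} (hd : 0 ≤ d)
    (hdm : d ^ 2 = 2 * m - 1) :
    tourLength (m + m) d (optimalTour m hm) = 8 * m - 4 + 2 * d := by
  have hm1 : (1 : ℝ) ≤ m := by exact_mod_cast hm
  have hedge : ∀ i ∈ Finset.range (3 * (m + m)),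
      eucl (pt (m + m) d (optimalTour m hm i)) (pt (m + m) d (optimalTour m hm (i + 1))) =
        1 + (if i = m - 1 then (m : ℝ) - 1 else 0) + (if i = 3 * m - 1 then (m : ℝ) - 1 else 0) +
          (if i = 4 * m - 1 then d - 1 else 0) + (if i = 6 * m - 1 then d - 1 else 0) := by
    intro i hi
    rw [Finset.mem_range] at hi
    have hdiag : ∀ x y : ℕ, x = y + (m - 1) →
        Real.sqrt (((x : ℝ) - y) ^ 2 + d ^ 2) = m := by
      intro x y hxy
      rw [hdm, hxy, Nat.cast_add, Nat.cast_sub (by omega)]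
      rw [Real.sqrt_eq_iff_mul_self_eq (by nlinarith) (by linarith)]
      push_cast
      ring
    have hvert : ∀ x y : ℕ, x = y → Real.sqrt (((x : ℝ) - y) ^ 2 + d ^ 2) = d := by
      rintro x _ rfl
      simp [Real.sqrt_sq hd]
    by_cases h1 : i = m - 1
    · rw [eucl_pt_of_row_adj, hdiag, if_pos h1, if_neg, if_neg, if_neg]
      · ring
      all_goals first
        | omega
        | simp only [optimalTour, optimalCol, optimalRow]; split_ifs <;> omega
    by_cases h2 : i = 3 * m - 1
    · rw [eucl_pt_of_row_adj, hdiag, if_neg h1, if_pos h2, if_neg, if_neg]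
      · ring
      all_goals first
        | omega
        | simp only [optimalTour, optimalCol, optimalRow]; split_ifs <;> omega
    by_cases h3 : i = 4 * m - 1
    · rw [eucl_pt_of_row_adj, hvert, if_neg h1, if_neg h2, if_pos h3, if_neg]
      · ring
      all_goals first
        | omega
        | simp only [optimalTour, optimalCol, optimalRow]; split_ifs <;> omega
    by_cases h4 : i = 6 * m - 1
    · rw [eucl_pt_of_row_adj, hvert, if_neg h1, if_neg h2, if_neg h3, if_pos h4]
      · ring
      all_goals first
        | omega
        | simp only [optimalTour, optimalCol, optimalRow]; split_ifs <;> omega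
    · rw [eucl_pt_of_row_eq, if_neg h1, if_neg h2, if_neg h3, if_neg h4]
      · have hstep : optimalCol m (i + 1) = optimalCol m i + 1 ∨
            optimalCol m i = optimalCol m (i + 1) + 1 := by
          unfold optimalCol
          split_ifs <;> omega
        simp only [optimalTour]
        rcases hstep with h | h <;> rw [h] <;> simp
      · simp only [optimalTour, optimalRow]
        split_ifs <;> omega
  unfold tourLength
  rw [Finset.sum_congr rfl hedge]
  simp only [Finset.sum_add_distrib, Finset.sum_ite_eq', Finset.mem_range]
  rw [if_pos (by omega), if_pos (by omega), if_pos (by omega), if_pos (by omega)]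
  simp only [Finset.sum_const, Finset.card_range, nsmul_eq_mul]
  push_cast
  ring

/-- For even `n ≥ 17`, the minimum length of a TSP tour of `G(n, √(n−1))`
equals `4n − 4 + 2√(n−1)`. -/
theorem statement12 (n : ℕ) (hn : 17 ≤ n) (hne : Even n) :
    IsLeast {L : ℝ | ∃ t, IsTour n t ∧ tourLength n (Real.sqrt ((n : ℝ) - 1)) t = L}
      (4 * (n : ℝ) - 4 + 2 * Real.sqrt ((n : ℝ) - 1)) := by
  constructor
  · obtain ⟨m, rfl⟩ := hne
    have hm : 0 < m := by omega
    have hm1 : (1 : ℝ) ≤ m := by exact_mod_cast hm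
    refine ⟨optimalTour m hm, isTour_optimalTour m hm, ?_⟩
    rw [tourLength_optimalTour hm (Real.sqrt_nonneg _)]
    · push_cast
      ring
    · push_cast
      rw [Real.sq_sqrt (by linarith)]
      ring
  · rintro L ⟨t, ht, rfl⟩
    exact le_tourLength (by omega) ht

end
end

section
/- Let n ≥ 2 be a natural number and define g(k) := 3n − 2k + 2√(n−1) − 2 + √(n² + 4nk(k−1)) for real k ≥ 1. Then g is strictly increasing on (1, ∞); in particular, g(k) > g(1) for every integer k with 2 ≤ k ≤ n/2. -/
open Real Filter Finset

noncomputable section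

/-- On `[1, ∞)` the function `k ↦ √(n² + 4nk(k-1))` grows faster than `2k` when `n > 1`. -/
theorem two_mul_sub_lt_sqrt_sub_sqrt {n a b : ℝ} (hn : 1 < n) (ha : 1 ≤ a) (hab : a < b) :
    2 * (b - a) < √(n ^ 2 + 4 * n * b * (b - 1)) - √(n ^ 2 + 4 * n * a * (a - 1)) := by
  have hn0 : 0 < n := by linarith
  have ha1 : 0 ≤ a * (a - 1) := mul_nonneg (by linarith) (by linarith)
  have hrad : 0 ≤ n ^ 2 + 4 * n * a * (a - 1) := by nlinarith [mul_nonneg hn0.le ha1]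
  have hle : √(n ^ 2 + 4 * n * a * (a - 1)) ≤ n * (2 * a - 1) := by
    apply Real.sqrt_le_iff.mpr
    refine ⟨mul_nonneg hn0.le (by linarith), ?_⟩
    nlinarith [mul_nonneg (mul_nonneg hn0.le (sub_nonneg.mpr hn.le)) ha1]
  have hsq := Real.sq_sqrt hrad
  have hnonneg := Real.sqrt_nonneg (n ^ 2 + 4 * n * a * (a - 1))
  set s := √(n ^ 2 + 4 * n * a * (a - 1))
  have hd : 0 < b - a := sub_pos.mpr hab
  have hsum : s + (b - a) < n * (a + b - 1) := by
    nlinarith [mul_pos (sub_pos.mpr hn) hd]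
  have hlt : s + 2 * (b - a) < √(n ^ 2 + 4 * n * b * (b - 1)) := by
    apply Real.lt_sqrt_of_sq_lt
    nlinarith [mul_pos hd (sub_pos.mpr hsum)]
  linarith

/-- For a natural number `n ≥ 2`, the function
`g(k) = 3n − 2k + 2√(n−1) − 2 + √(n² + 4nk(k−1))` is strictly increasing on
`(1, ∞)`; in particular `g(k) > g(1)` for every integer `k` with `2 ≤ k ≤ n/2`. -/
theorem statement13 (n : ℕ) (hn : 2 ≤ n) (g : ℝ → ℝ)
    (hg : ∀ k : ℝ, g k = 3 * (n : ℝ) - 2 * k + 2 * Real.sqrt ((n : ℝ) - 1) - 2 +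
      Real.sqrt ((n : ℝ) ^ 2 + 4 * (n : ℝ) * k * (k - 1))) :
    StrictMonoOn g (Set.Ioi (1 : ℝ)) ∧
    ∀ k : ℕ, 2 ≤ k → (k : ℝ) ≤ (n : ℝ) / 2 → g 1 < g (k : ℝ) := by
  have hn1 : (1 : ℝ) < n := by exact_mod_cast hn
  have hmono : ∀ a b : ℝ, 1 ≤ a → a < b → g a < g b := by
    intro a b ha hab
    rw [hg, hg]
    linarith [two_mul_sub_lt_sqrt_sub_sqrt hn1 ha hab]
  refine ⟨fun a ha b _ hab => hmono a b (le_of_lt ha) hab, fun k hk _ => ?_⟩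
  exact hmono 1 k le_rfl (by exact_mod_cast hk)

end
end
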